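/- In the minimal tree realization M(C; T, ω), dim(C*_v) = dim(C) − ∑_{e ∈ E(v)} dim(C_{J(e)}) for each vertex v, where for e ∈ E(v), T_e is the component of T − e not containing v and J(e) = ω^{-1}(V(T_e)). -/

import Mathlib

open Module

open scoped Classical

/-- The submodule of vectors in `F^I` supported inside `J` (vanishing outside `J`). -/
def suppSub (F : Type*) [Field F] {I : Type*} (J : Set I) : Submodule F (I → F) where
  carrier := {x | ∀ i ∉ J, x i = 0}
  add_mem' := by
    intro a b ha hb i hi
    show a i + b i = 0
    rw [ha i hi, hb i hi, add_zero]
  zero_mem' := fun i _ => rfl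
  smul_mem' := by
    intro c a ha i hi
    show c • a i = 0
    rw [ha i hi, smul_zero]

variable {F : Type*} [Field F] {I V : Type*} [Fintype I] [Fintype V]

/-- The projection `C|_J` of a code `C ⊆ F^I` onto the coordinates in `J`. -/
noncomputable def projCode (C : Submodule F (I → F)) (J : Set I) : Submodule F (↥J → F) :=
  C.map (LinearMap.funLeft F F (Subtype.val : ↥J → I))

/-- The cross-section `C_J = {c|_J : c ∈ C, c|_{I∖J} = 0}`. -/
noncomputable def crossCode (C : Submodule F (I → F)) (J : Set I) : Submodule F (↥J → F) :=
  (C ⊓ suppSub F J).map (LinearMap.funLeft F F (Subtype.val : ↥J → I))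

/-- For adjacent vertices `v, w`, the index set `J(e)` carried by the component of
`T − e` containing `w` (i.e., not containing `v`), for the edge `e = {v,w}`. -/
def edgeIndexSet (G : SimpleGraph V) (ω : I → V) (v w : V) : Set I :=
  ω ⁻¹' {z | (G.deleteEdges {s(v, w)}).Reachable z w}

/-- The subspace `C_{J(e)} ⊕ C_{J̄(e)}` of `C` (as a submodule of `↥C`), for the
edge `e = {v,w}`. -/
noncomputable def edgeSub (G : SimpleGraph V) (ω : I → V) (C : Submodule F (I → F))
    (v w : V) : Submodule F ↥C :=
  ((C ⊓ suppSub F (edgeIndexSet G ω v w)) ⊔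
    (C ⊓ suppSub F (edgeIndexSet G ω v w)ᶜ)).comap C.subtype


section InstanceHelpers

variable (C : Submodule F (I → F)) {A B : Type*} (N : A → Submodule F ↥C)

noncomputable instance submoduleQuotPiAddCommGroup
    (P : Submodule F ((B → F) × ((a : A) → ↥C ⧸ N a))) : AddCommGroup ↥P :=
  letI m1 : AddCommGroup ((B → F) × ((a : A) → ↥C ⧸ N a)) := inferInstance
  letI m2 : Module F ((B → F) × ((a : A) → ↥C ⧸ N a)) := inferInstance
  Submodule.addCommGroup P

noncomputable instance submoduleQuotPiModule
    (P : Submodule F ((B → F) × ((a : A) → ↥C ⧸ N a))) : Module F ↥P :=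
  letI m1 : AddCommGroup ((B → F) × ((a : A) → ↥C ⧸ N a)) := inferInstance
  letI m2 : Module F ((B → F) × ((a : A) → ↥C ⧸ N a)) := inferInstance
  Submodule.module P

end InstanceHelpers

/-- The map realizing the minimal local constraint code `C*_v`:
`c ↦ (c|_{ω⁻¹(v)}, (s*_e(c))_{e ∈ E(v)})`, where incident edges are parametrized by the
neighbors `w` of `v` and `s*_e : C → C/(C_{J(e)} ⊕ C_{J̄(e)})` is the quotient map. -/
noncomputable def cStarMap (G : SimpleGraph V) (ω : I → V) (C : Submodule F (I → F))
    (v : V) :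
    ↥C →ₗ[F] ((↥(ω ⁻¹' {v}) → F) ×
      ((w : ↥(G.neighborSet v)) → (↥C ⧸ edgeSub G ω C v w.val))) :=
  LinearMap.prod
    ((LinearMap.funLeft F F Subtype.val).comp C.subtype)
    (LinearMap.pi (fun w => (edgeSub G ω C v w.val).mkQ))

/-- The minimal local constraint code `C*_v`. -/
noncomputable def cStar (G : SimpleGraph V) (ω : I → V) (C : Submodule F (I → F))
    (v : V) :=
  LinearMap.range (cStarMap G ω C v)

/-- Deleting the edge `{v, w}` of an acyclic graph separates `v` from `w`. -/
theorem SimpleGraph.IsAcyclic.not_reachable_deleteEdges {W : Type*} {G : SimpleGraph W}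
    (hG : G.IsAcyclic) {v w : W} (h : G.Adj v w) :
    ¬ (G.deleteEdges {s(v, w)}).Reachable v w :=
  SimpleGraph.isBridge_iff.mp (SimpleGraph.isAcyclic_iff_forall_adj_isBridge.mp hG h)

/-- A vertex on the far side of the edge `{v, w}` is joined to `w` by a path avoiding `v`. -/
theorem SimpleGraph.IsAcyclic.exists_isPath_notMem_support {W : Type*} {G : SimpleGraph W}
    (hG : G.IsAcyclic) {v w z : W} (h : G.Adj v w)
    (hz : (G.deleteEdges {s(v, w)}).Reachable z w) :
    ∃ p : G.Walk w z, p.IsPath ∧ v ∉ p.support := by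
  obtain ⟨p, hp⟩ := hz.symm.exists_isPath
  refine ⟨p.mapLe (G.deleteEdges_le _), hp.mapLe _, fun hv => ?_⟩
  rw [SimpleGraph.Walk.support_mapLe_eq_support] at hv
  exact hG.not_reachable_deleteEdges h ⟨(p.takeUntil v hv).reverse⟩

/-- The components hanging off a vertex of an acyclic graph are pairwise disjoint. -/
theorem SimpleGraph.IsAcyclic.eq_of_reachable_deleteEdges {W : Type*} {G : SimpleGraph W}
    (hG : G.IsAcyclic) {v w w' z : W} (h : G.Adj v w) (h' : G.Adj v w')
    (hz : (G.deleteEdges {s(v, w)}).Reachable z w)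
    (hz' : (G.deleteEdges {s(v, w')}).Reachable z w') : w = w' := by
  obtain ⟨p, hp, hv⟩ := hG.exists_isPath_notMem_support h hz
  obtain ⟨q, hq, hv'⟩ := hG.exists_isPath_notMem_support h' hz'
  have key := (hG.subsingleton_path v z).elim ⟨_, hp.cons (h := h) hv⟩ ⟨_, hq.cons (h := h') hv'⟩
  simpa using congrArg (fun r : G.Path v z => r.1.snd) key

/-- Every vertex of a connected graph other than `v` is reached from a neighbor of `v` without
using the edge to that neighbor. -/
theorem SimpleGraph.Connected.exists_adj_reachable_deleteEdges {W : Type*} {G : SimpleGraph W}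
    (hG : G.Connected) {v z : W} (hz : z ≠ v) :
    ∃ w, G.Adj v w ∧ (G.deleteEdges {s(v, w)}).Reachable z w := by
  obtain ⟨p, hp⟩ := (hG v z).exists_isPath
  cases p with
  | nil => exact absurd rfl hz
  | @cons _ w _ h q =>
    rw [SimpleGraph.Walk.cons_isPath_iff] at hp
    exact ⟨w, h, ⟨(q.toDeleteEdge s(v, w)
      fun he => hp.2 (q.fst_mem_support_of_mem_edges he)).reverse⟩⟩

theorem suppSub_mono {K ι : Type*} [Field K] {J J' : Set ι} (h : J ⊆ J') :
    suppSub K J ≤ suppSub K J' :=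
  fun _ hx i hi => hx i fun hJ => hi (h hJ)

/-- A cross-section has the dimension of the subcode supported on the index set. -/
theorem finrank_crossCode {K ι : Type*} [Field K] (C : Submodule K (ι → K)) (J : Set ι) :
    finrank K (crossCode C J) = finrank K ↥(C ⊓ suppSub K J) := by
  have hinj : Function.Injective ((LinearMap.funLeft K K (Subtype.val : ↥J → ι)).domRestrict
      (C ⊓ suppSub K J)) := by
    rw [← LinearMap.ker_eq_bot, LinearMap.ker_eq_bot']
    rintro ⟨x, hx⟩ h
    ext i
    by_cases hi : i ∈ J
    · exact congrFun h ⟨i, hi⟩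
    · exact hx.2 i hi
  have := LinearMap.finrank_range_of_inj hinj
  rwa [LinearMap.range_domRestrict] at this

/-- Subcodes supported on pairwise disjoint index sets are independent: their dimensions add. -/
theorem finrank_iSup_inf_suppSub {K ι A : Type*} [Field K] [Finite ι] [Fintype A]
    (C : Submodule K (ι → K)) (J : A → Set ι) (hJ : Pairwise (Function.onFun Disjoint J)) :
    finrank K ↥(⨆ a, C ⊓ suppSub K (J a)) = ∑ a, finrank K ↥(C ⊓ suppSub K (J a)) := by
  let f : ((a : A) → ↥(C ⊓ suppSub K (J a))) →ₗ[K] (ι → K) :=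
    LinearMap.lsum K _ K fun a => (C ⊓ suppSub K (J a)).subtype
  have hinj : Function.Injective f := by
    rw [← LinearMap.ker_eq_bot, LinearMap.ker_eq_bot']
    intro x hx
    ext a i
    by_cases hi : i ∈ J a
    · have hsum : ∑ b, (x b : ι → K) i = 0 := by
        simpa [f, LinearMap.lsum_apply] using congrFun hx i
      rwa [Finset.sum_eq_single_of_mem a (Finset.mem_univ a) fun b _ hb =>
        (x b).2.2 i (Set.disjoint_left.mp (hJ hb.symm) hi)] at hsum
    · exact (x a).2.2 i hi
  have hrange : LinearMap.range f = ⨆ a, C ⊓ suppSub K (J a) := by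
    apply le_antisymm
    · rintro _ ⟨x, rfl⟩
      simp only [f, LinearMap.lsum_apply, LinearMap.sum_apply]
      exact Submodule.sum_mem _ fun a _ => Submodule.mem_iSup_of_mem a (x a).2
    · exact iSup_le fun a c hc => ⟨Pi.single a ⟨c, hc⟩, LinearMap.lsum_piSingle ..⟩
  rw [← hrange, LinearMap.finrank_range_of_inj hinj, finrank_pi_fintype]

/-- Rank-nullity, with both modules given by their additive monoid structure only. -/
theorem finrank_range_add_finrank_ker_of_addCommMonoid {K M N : Type*} [Field K]
    [AddCommMonoid M] [Module K M] [Module.Finite K M] [AddCommMonoid N] [Module K N]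
    (f : M →ₗ[K] N) :
    finrank K ↥(LinearMap.range f) + finrank K ↥(LinearMap.ker f) = finrank K M := by
  let : AddCommGroup M := Module.addCommMonoidToAddCommGroup K
  let : AddCommGroup N := Module.addCommMonoidToAddCommGroup K
  exact LinearMap.finrank_range_add_finrank_ker f

/-- Rank-nullity for maps into a product of quotients of a code, with the module structure on the
range given by `submoduleQuotPiModule`. -/
theorem finrank_range_add_finrank_ker_quotPi {K ι A B : Type*} [Field K] [Finite ι]
    (C : Submodule K (ι → K)) (N : A → Submodule K ↥C)
    (f : ↥C →ₗ[K] ((B → K) × ((a : A) → ↥C ⧸ N a))) :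
    finrank K ↥(LinearMap.range f) + finrank K ↥(LinearMap.ker f) = finrank K ↥C :=
  finrank_range_add_finrank_ker_of_addCommMonoid f

/-- A codeword lies in the kernel of `cStarMap` exactly when it is a sum of codewords supported
on the components hanging off `v`. -/
theorem map_ker_cStarMap {K ι W : Type*} [Field K] [Fintype W]
    (G : SimpleGraph W) (hT : G.IsTree) (ω : ι → W) (C : Submodule K (ι → K)) (v : W) :
    (LinearMap.ker (cStarMap G ω C v)).map C.subtype =
      ⨆ w : ↥(G.neighborSet v), C ⊓ suppSub K (edgeIndexSet G ω v w.val) := by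
  apply le_antisymm
  · rintro _ ⟨c, hc, rfl⟩
    have hv : ∀ i, ω i = v → (c : ι → K) i = 0 := fun i hi =>
      congrFun (congrArg Prod.fst hc) ⟨i, hi⟩
    have hE : ∀ w : ↥(G.neighborSet v), ∃ a ∈ C ⊓ suppSub K (edgeIndexSet G ω v w.val),
        ∀ i ∈ edgeIndexSet G ω v w.val, a i = (c : ι → K) i := by
      intro w
      have hw : c ∈ edgeSub G ω C v w.val :=
        (Submodule.Quotient.mk_eq_zero _).mp (congrFun (congrArg Prod.snd hc) w)
      obtain ⟨a, ha, b, hb, hab⟩ := Submodule.mem_sup.mp hw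
      refine ⟨a, ha, fun i hi => ?_⟩
      have := congrFun hab i
      rwa [Pi.add_apply, hb.2 i (fun h => h hi), add_zero] at this
    choose a ha hac using hE
    have hsum : C.subtype c = ∑ w, a w := by
      ext i
      rw [Finset.sum_apply, Submodule.subtype_apply]
      by_cases hi : ω i = v
      · rw [hv i hi, Finset.sum_eq_zero]
        refine fun w _ => (ha w).2 i fun h => hT.isAcyclic.not_reachable_deleteEdges w.2 ?_
        exact hi ▸ h
      · obtain ⟨w, hw, hr⟩ := hT.connected.exists_adj_reachable_deleteEdges hi
        rw [Finset.sum_eq_single_of_mem ⟨w, hw⟩ (Finset.mem_univ _), hac ⟨w, hw⟩ i hr]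
        exact fun w' _ hne => (ha w').2 i fun h =>
          hne (Subtype.ext (hT.isAcyclic.eq_of_reachable_deleteEdges w'.2 hw h hr))
    rw [hsum]
    exact Submodule.sum_mem _ fun w _ => Submodule.mem_iSup_of_mem w (ha w)
  · refine iSup_le fun w c hc => ⟨⟨c, hc.1⟩, ?_, rfl⟩
    refine Prod.ext (funext fun i => hc.2 i fun h => ?_) (funext fun w' => ?_)
    · have hi : ω i = v := i.2
      have hr : (G.deleteEdges {s(v, w.val)}).Reachable (ω i) w := h
      rw [hi] at hr
      exact hT.isAcyclic.not_reachable_deleteEdges w.2 hr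
    · refine (Submodule.Quotient.mk_eq_zero _).mpr ?_
      by_cases hw : w' = w
      · subst hw
        exact Submodule.mem_sup_left hc
      · have hsub : edgeIndexSet G ω v w.val ⊆ (edgeIndexSet G ω v w'.val)ᶜ := fun i hi hi' =>
          hw (Subtype.ext (hT.isAcyclic.eq_of_reachable_deleteEdges w'.2 w.2 hi' hi))
        exact Submodule.mem_sup_right ⟨hc.1, suppSub_mono hsub hc.2⟩

/-- in the minimal tree realization,
`dim C*_v = dim C − ∑_{e ∈ E(v)} dim C_{J(e)}` (stated in subtraction-free form). -/
theorem cStar_finrank (G : SimpleGraph V) (hT : G.IsTree) (ω : I → V)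
    (C : Submodule F (I → F)) (v : V) :
    finrank F ↥(cStar G ω C v) +
        ∑ w : ↥(G.neighborSet v), finrank F ↥(crossCode C (edgeIndexSet G ω v w.val)) =
      finrank F ↥C := by
  have hker : ∑ w : ↥(G.neighborSet v), finrank F ↥(crossCode C (edgeIndexSet G ω v w.val)) =
      finrank F ↥(LinearMap.ker (cStarMap G ω C v)) := by
    have hJ : Pairwise (Function.onFun Disjoint
        fun w : ↥(G.neighborSet v) => edgeIndexSet G ω v w.val) :=
      fun w w' hne => Set.disjoint_left.mpr fun i hi hi' =>
        hne (Subtype.ext (hT.isAcyclic.eq_of_reachable_deleteEdges w.2 w'.2 hi hi'))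
    simp only [finrank_crossCode]
    rw [← Submodule.finrank_map_subtype_eq, map_ker_cStarMap G hT]
    exact (finrank_iSup_inf_suppSub C _ hJ).symm
  rw [hker]
  exact finrank_range_add_finrank_ker_quotPi C _ (cStarMap G ω C v)
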